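/- Let G be a bridgeless cubic graph and let e* be an edge of G. Then there exists a perfect matching of G that contains e*. -/

import Mathlib

open SimpleGraph Set

/-- The edge cut `δ(A)`: edges of `G` with exactly one endpoint in `A`. -/
def edgeCut {V : Type*} (G : SimpleGraph V) (A : Set V) : Set (Sym2 V) :=
  {e | e ∈ G.edgeSet ∧ ∃ u v, e = s(u, v) ∧ u ∈ A ∧ v ∉ A}

/-- A graph is cubic if every vertex has exactly three neighbours. -/
def IsCubic {V : Type*} (G : SimpleGraph V) : Prop :=
  ∀ v : V, (G.neighborSet v).ncard = 3

/-- A graph is bridgeless if it has no bridge. -/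
def Bridgeless {V : Type*} (G : SimpleGraph V) : Prop :=
  ∀ e : Sym2 V, ¬ G.IsBridge e

/-- A perfect matching viewed as a set of edges: pairwise disjoint edges of `G`
covering every vertex exactly once. -/
def IsPerfectMatchingSet {V : Type*} (G : SimpleGraph V) (M : Set (Sym2 V)) : Prop :=
  M ⊆ G.edgeSet ∧ ∀ v : V, ∃! e, e ∈ M ∧ v ∈ e

open Classical in
/-- The darts of `G` leaving `C`: adjacent ordered pairs whose first vertex lies in `C` and whose
second vertex does not. -/
noncomputable def outDarts {V : Type*} [Fintype V] (G : SimpleGraph V) (C : Finset V) :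
    Finset (V × V) :=
  {p | G.Adj p.1 p.2 ∧ p.1 ∈ C ∧ p.2 ∉ C}

theorem mem_outDarts {V : Type*} [Fintype V] {G : SimpleGraph V} {C : Finset V} {p : V × V} :
    p ∈ outDarts G C ↔ G.Adj p.1 p.2 ∧ p.1 ∈ C ∧ p.2 ∉ C := by
  simp [outDarts]

open Classical in
theorem card_adj_of_fst_mem {V : Type*} [Fintype V] {G : SimpleGraph V} (hG : IsCubic G)
    (C : Finset V) :
    (Finset.univ.filter fun p : V × V => G.Adj p.1 p.2 ∧ p.1 ∈ C).card = 3 * C.card := by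
  have key : (Finset.univ.filter fun p : V × V => G.Adj p.1 p.2 ∧ p.1 ∈ C)
      = (C.sigma fun v => G.neighborFinset v).map
        (Equiv.sigmaEquivProd V V).toEmbedding := by
    ext ⟨a, b⟩
    simp [and_comm, Equiv.sigmaEquivProd]
  have hdeg : ∀ v, (G.neighborFinset v).card = 3 := fun v => by
    rw [← hG v, Set.ncard_eq_toFinset_card', SimpleGraph.neighborFinset]
  rw [key, Finset.card_map, Finset.card_sigma, Finset.sum_congr rfl fun v _ => hdeg v]
  simp [mul_comm]

open Classical in
theorem even_card_adj_of_mem {V : Type*} [Fintype V] (G : SimpleGraph V) (C : Finset V) :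
    Even (Finset.univ.filter fun p : V × V => G.Adj p.1 p.2 ∧ p.1 ∈ C ∧ p.2 ∈ C).card := by
  rw [← ZMod.natCast_eq_zero_iff_even, Finset.cast_card]
  refine Finset.sum_involution (fun p _ => p.swap) (fun _ _ => by decide) ?_ ?_ ?_
  · rintro ⟨a, b⟩ h - heq
    have := (Finset.mem_filter.1 h).2.1.ne
    simp_all
  · rintro ⟨a, b⟩ h
    simp_all [G.adj_comm]
  · simp

theorem even_card_of_isCubic {V : Type*} [Fintype V] {G : SimpleGraph V} (hG : IsCubic G) :
    Even (Nat.card V) := by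
  classical
  have h := even_card_adj_of_mem G Finset.univ
  have heq : (Finset.univ.filter fun p : V × V =>
      G.Adj p.1 p.2 ∧ p.1 ∈ Finset.univ ∧ p.2 ∈ Finset.univ)
      = Finset.univ.filter fun p : V × V => G.Adj p.1 p.2 ∧ p.1 ∈ Finset.univ :=
    Finset.filter_congr fun p _ => by simp
  rw [heq, card_adj_of_fst_mem hG, Finset.card_univ, Nat.even_mul] at h
  rw [Nat.card_eq_fintype_card]
  exact h.resolve_left (by decide)

theorem odd_card_outDarts {V : Type*} [Fintype V] {G : SimpleGraph V} (hG : IsCubic G)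
    {C : Finset V} (hC : Odd C.card) : Odd (outDarts G C).card := by
  classical
  have h := card_adj_of_fst_mem hG C
  have h' := even_card_adj_of_mem G C
  rw [← Finset.card_filter_add_card_filter_not (fun p : V × V => p.2 ∈ C), Finset.filter_filter,
    Finset.filter_filter] at h
  simp only [and_assoc] at h
  have h'' : Odd (3 * C.card) := Odd.mul (by decide) hC
  rw [← h, Nat.odd_add'] at h''
  simpa only [outDarts] using h''.2 h'

theorem card_outDarts_ne_one {V : Type*} [Fintype V] {G : SimpleGraph V}
    (hG : ∀ e ∈ G.edgeSet, ¬ G.IsBridge e) (C : Finset V) : (outDarts G C).card ≠ 1 := by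
  intro h
  obtain ⟨⟨v, w⟩, hvw⟩ := Finset.card_eq_one.1 h
  obtain ⟨hadj, hv, hw⟩ := mem_outDarts.1 (hvw ▸ Finset.mem_singleton_self (v, w))
  refine hG s(v, w) hadj (SimpleGraph.isBridge_iff.2 ?_)
  rintro ⟨p⟩
  obtain ⟨d, -, hd₁, hd₂⟩ := p.exists_boundary_dart (C : Set V) hv hw
  have hd := d.adj
  rw [SimpleGraph.deleteEdges_adj] at hd
  have hmem : (d.fst, d.snd) ∈ outDarts G C := mem_outDarts.2 ⟨hd.1, hd₁, hd₂⟩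
  rw [hvw, Finset.mem_singleton, Prod.mk.injEq] at hmem
  exact hd.2 (by rw [hmem.1, hmem.2]; rfl)

theorem three_le_card_outDarts {V : Type*} [Fintype V] {G : SimpleGraph V} (hG : IsCubic G)
    (hbridge : ∀ e ∈ G.edgeSet, ¬ G.IsBridge e) {C : Finset V} (hC : Odd C.card) :
    3 ≤ (outDarts G C).card := by
  obtain ⟨k, hk⟩ := odd_card_outDarts hG hC
  have := card_outDarts_ne_one hbridge C
  lia

/-- The graph obtained from `G` by deleting every edge at `x` except the one towards `y`. -/
def isolateEdge {V : Type*} (G : SimpleGraph V) (x y : V) : SimpleGraph V where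
  Adj a b := G.Adj a b ∧ (a = x → b = y) ∧ (b = x → a = y)
  symm := ⟨fun _ _ h => ⟨h.1.symm, h.2.2, h.2.1⟩⟩
  loopless := ⟨fun _ h => h.1.ne rfl⟩

open Classical in
theorem card_outDarts_biUnion_le {V ι : Type*} [Fintype V] {G : SimpleGraph V}
    (hG : IsCubic G) {x y : V} (hxy : G.Adj x y) (u : Finset V) (s : Finset ι) (C : ι → Finset V)
    (hC : ∀ i ∈ s, ∀ v ∈ C i, ∀ w, (isolateEdge G x y).Adj v w → w ∉ u → w ∈ C i) :
    (s.biUnion fun i => outDarts G (C i)).card ≤ 3 * u.card + 4 := by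
  set N := (G.neighborFinset x).erase y with hN
  have hNcard : N.card = 2 := by
    rw [hN, Finset.card_erase_of_mem (by simpa using hxy), SimpleGraph.neighborFinset,
      ← Set.ncard_eq_toFinset_card', hG x]
  have hsub : (s.biUnion fun i => outDarts G (C i)) ⊆
      (Finset.univ.filter fun p : V × V => G.Adj p.1 p.2 ∧ p.1 ∈ u).image Prod.swap ∪
        (N.image (fun a => (x, a)) ∪ N.image (fun a => (a, x))) := by
    rintro ⟨v, w⟩ h
    obtain ⟨i, hi, h⟩ := Finset.mem_biUnion.1 h
    obtain ⟨hadj, hv, hw⟩ := mem_outDarts.1 h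
    have hadj' := hadj.symm
    have := hC i hi v hv w
    simp only [isolateEdge] at this
    simp only [Finset.mem_union, Finset.mem_image, Finset.mem_filter, Finset.mem_univ, true_and,
      Prod.exists, Prod.swap_prod_mk, Prod.mk.injEq, hN, Finset.mem_erase,
      SimpleGraph.mem_neighborFinset]
    grind
  have h₁ := card_adj_of_fst_mem hG u
  have h₂ := Finset.card_le_card hsub
  have h₃ := Finset.card_union_le
    ((Finset.univ.filter fun p : V × V => G.Adj p.1 p.2 ∧ p.1 ∈ u).image Prod.swap)
    (N.image (fun a => (x, a)) ∪ N.image (fun a => (a, x)))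
  have h₄ := Finset.card_union_le (N.image (fun a => (x, a))) (N.image (fun a => (a, x)))
  have h₅ : (N.image (fun a => (x, a))).card ≤ N.card := Finset.card_image_le
  have h₆ : (N.image (fun a => (a, x))).card ≤ N.card := Finset.card_image_le
  have h₇ := Finset.card_image_le (f := Prod.swap)
    (s := Finset.univ.filter fun p : V × V => G.Adj p.1 p.2 ∧ p.1 ∈ u)
  lia

theorem not_isTutteViolator_isolateEdge {V : Type*} [Fintype V] {G : SimpleGraph V}
    (hG : IsCubic G) (hbridge : ∀ e ∈ G.edgeSet, ¬ G.IsBridge e) {x y : V} (hxy : G.Adj x y)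
    (u : Set V) : ¬ (isolateEdge G x y).IsTutteViolator u := by
  classical
  intro hu
  rw [SimpleGraph.IsTutteViolator] at hu
  set K := ((⊤ : (isolateEdge G x y).Subgraph).deleteVerts u).coe with hK
  have hmem : ∀ v, v ∈ ((⊤ : (isolateEdge G x y).Subgraph).deleteVerts u).verts ↔ v ∉ u := by
    simp
  let s : Finset K.ConnectedComponent := K.oddComponents.toFinset
  let C : K.ConnectedComponent → Finset V := fun c => (Subtype.val '' c.supp).toFinset
  have hCmem : ∀ c v, v ∈ C c ↔ ∃ h, K.connectedComponentMk ⟨v, h⟩ = c := by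
    simp [C]
  have hs : s.card = K.oddComponents.ncard := (Set.ncard_eq_toFinset_card' _).symm
  have hodd : ∀ c ∈ s, Odd (C c).card := by
    intro c hc
    rw [← Set.ncard_eq_toFinset_card', Set.ncard_image_of_injective _ Subtype.val_injective]
    simpa [s] using hc
  have hparity : u.ncard + 2 ≤ s.card := by
    have h := SimpleGraph.odd_ncard_oddComponents (G := K)
    have hcard : Nat.card ((⊤ : (isolateEdge G x y).Subgraph).deleteVerts u).verts
        = uᶜ.ncard := by
      rw [Nat.card_coe_set_eq]
      congr 1
      ext v
      simp
    have hsum := Set.ncard_add_ncard_compl u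
    have heven := even_card_of_isCubic hG
    rw [hcard] at h
    rw [hs]
    grind
  have hdisj : (s : Set K.ConnectedComponent).PairwiseDisjoint fun c => outDarts G (C c) := by
    intro c _ d _ hcd
    refine Finset.disjoint_left.2 fun p hp hq => hcd ?_
    obtain ⟨_, h⟩ := (hCmem c _).1 (mem_outDarts.1 hp).2.1
    obtain ⟨_, h'⟩ := (hCmem d _).1 (mem_outDarts.1 hq).2.1
    exact h.symm.trans h'
  have hle := card_outDarts_biUnion_le hG hxy u.toFinset s C (by
    intro c _ v hv w hvw hw
    obtain ⟨hv', hc⟩ := (hCmem c v).1 hv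
    have hw' := (hmem w).2 (by simpa using hw)
    refine (hCmem c w).2 ⟨hw', ?_⟩
    rw [← hc]
    refine SimpleGraph.ConnectedComponent.connectedComponentMk_eq_of_adj ?_
    have hv'' := (hmem v).1 hv'
    have hw'' := (hmem w).1 hw'
    simp [hK, hv'', hw'', hvw.symm])
  rw [Finset.card_biUnion hdisj, ← Set.ncard_eq_toFinset_card'] at hle
  have hge := Finset.card_nsmul_le_sum s (fun c => (outDarts G (C c)).card) 3
    fun c hc => three_le_card_outDarts hG hbridge (hodd c hc)
  rw [smul_eq_mul] at hge
  lia

theorem isPerfectMatchingSet_edgeSet {V : Type*} {G H : SimpleGraph V} (hHG : H ≤ G)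
    {M : H.Subgraph} (hM : M.IsPerfectMatching) : IsPerfectMatchingSet G M.edgeSet := by
  refine ⟨M.edgeSet_subset.trans (SimpleGraph.edgeSet_mono hHG), fun v => ?_⟩
  obtain ⟨w, hw, huniq⟩ := SimpleGraph.Subgraph.isPerfectMatching_iff.1 hM v
  refine ⟨s(v, w), ⟨hw, Sym2.mem_mk_left v w⟩, ?_⟩
  rintro e ⟨he, hve⟩
  obtain ⟨z, rfl⟩ := Sym2.mem_iff_exists.1 hve
  rw [huniq z he]

theorem stmt_0 {V : Type*} [Fintype V] (G : SimpleGraph V)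
    (hcubic : IsCubic G) (hbridgeless : Bridgeless G)
    (estar : Sym2 V) (he : estar ∈ G.edgeSet) :
    ∃ M : Set (Sym2 V), IsPerfectMatchingSet G M ∧ estar ∈ M := by
  induction estar with
  | h x y =>
    obtain ⟨M, hM⟩ := SimpleGraph.tutte.2
      (not_isTutteViolator_isolateEdge hcubic (fun e _ => hbridgeless e) he)
    have hle : isolateEdge G x y ≤ G := fun _ _ h => h.1
    refine ⟨M.edgeSet, isPerfectMatchingSet_edgeSet hle hM, ?_⟩
    obtain ⟨w, hw, -⟩ := SimpleGraph.Subgraph.isPerfectMatching_iff.1 hM x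
    obtain rfl := hw.adj_sub.2.1 rfl
    exact hw
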